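/- Let s > 0 and let c be a speed with 0 < c < 2/√s. Then there is no positive unbounded traveling wave of speed c for the equation u_t = u_xx + u³/(1+s u²); that is, there is no twice differentiable function φ : ℝ → ℝ with φ(ξ) > 0 for all ξ, satisfying φ''(ξ) + c·φ'(ξ) + φ(ξ)³/(1 + s·φ(ξ)²) = 0 for all ξ ∈ ℝ, which is monotonically decreasing and satisfies φ(ξ) → +∞ as ξ → -∞ and φ(ξ) → 0 as ξ → +∞. -/

import Mathlib

open Filter

/-- For `0 < c < 2/√s` there is no positive unbounded traveling wave
(monotonically decreasing, positive, connecting `∞` and `0`) of speed `c` for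
`u_t = u_xx + u³/(1+s u²)`. -/
theorem no_positive_unbounded_traveling_wave_below_critical_speed
    (s c : ℝ) (hs : 0 < s) (hc : 0 < c) (hcs : c < 2 / Real.sqrt s) :
    ¬ ∃ φ : ℝ → ℝ,
      (∀ ξ : ℝ, DifferentiableAt ℝ φ ξ) ∧
      (∀ ξ : ℝ, DifferentiableAt ℝ (deriv φ) ξ) ∧
      (∀ ξ : ℝ, 0 < φ ξ) ∧
      (∀ ξ : ℝ, deriv (deriv φ) ξ + c * deriv φ ξ + (φ ξ) ^ 3 / (1 + s * (φ ξ) ^ 2) = 0) ∧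
      Antitone φ ∧
      Tendsto φ atBot atTop ∧
      Tendsto φ atTop (nhds 0) := by
  rintro ⟨φ, h1, h2, hpos, hode, hanti, htop, -⟩
  have hcs2 : c ^ 2 * s < 4 := by
    have hr : 0 < Real.sqrt s := Real.sqrt_pos.mpr hs
    have h := (lt_div_iff₀ hr).mp hcs
    have h3 : (c * Real.sqrt s) ^ 2 < 2 ^ 2 := by
      apply pow_lt_pow_left₀ h (by positivity) (by norm_num)
    rw [mul_pow, Real.sq_sqrt hs.le] at h3
    linarith
  obtain ⟨δ, hδ, hK⟩ : ∃ δ : ℝ, 0 < δ ∧ (c ^ 2 / 4 + δ) * s < 1 := by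
    refine ⟨(1 - c ^ 2 * s / 4) / (2 * s), div_pos (by linarith) (by linarith), ?_⟩
    have : (c ^ 2 / 4 + (1 - c ^ 2 * s / 4) / (2 * s)) * s = (1 + c ^ 2 * s / 4) / 2 := by
      field_simp
      ring
    rw [this]
    linarith
  set K := c ^ 2 / 4 + δ with hKdef
  obtain ⟨M, hM⟩ := (htop.eventually_ge_atTop (max 1 (K / (1 - K * s)))).exists
  have hq : ∀ x ≤ M, K ≤ φ x ^ 2 / (1 + s * φ x ^ 2) := by
    intro x hx
    have h := hM.trans (hanti hx)
    have h3 := (le_max_left _ _).trans h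
    have h4 := (div_le_iff₀ (by linarith)).mp ((le_max_right _ _).trans h)
    rw [le_div_iff₀ (by positivity)]
    have h5 : φ x * (1 - K * s) ≤ φ x ^ 2 * (1 - K * s) :=
      mul_le_mul_of_nonneg_right (by nlinarith) (by linarith)
    nlinarith
  have hnonpos : ∀ x, deriv φ x ≤ 0 := fun x => hanti.deriv_nonpos
  have hw : ∀ x, HasDerivAt (fun y => deriv φ y / φ y)
      ((deriv (deriv φ) x * φ x - deriv φ x * deriv φ x) / φ x ^ 2) x := fun x =>
    (h2 x).hasDerivAt.div (h1 x).hasDerivAt (hpos x).ne'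
  have hwle : ∀ x ≤ M,
      (deriv (deriv φ) x * φ x - deriv φ x * deriv φ x) / φ x ^ 2 ≤ -δ := by
    intro x hx
    have hp := hpos x
    have hq' := hq x hx
    have hd : deriv (deriv φ) x
        = -(c * deriv φ x) - φ x * (φ x ^ 2 / (1 + s * φ x ^ 2)) * φ x ^ 0 := by
      have h := hode x
      have e : φ x ^ 3 / (1 + s * φ x ^ 2) = φ x * (φ x ^ 2 / (1 + s * φ x ^ 2)) := by ring
      rw [e] at h
      rw [pow_zero, mul_one]
      linarith
    generalize φ x ^ 2 / (1 + s * φ x ^ 2) = q at hq' hd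
    rw [div_le_iff₀ (by positivity), hd]
    have h6 : K * φ x ^ 2 ≤ q * φ x ^ 2 := mul_le_mul_of_nonneg_right hq' (by positivity)
    rw [hKdef] at h6
    nlinarith [sq_nonneg (deriv φ x + c / 2 * φ x)]
  set L := -(deriv φ M / φ M) with hL
  have hL0 : 0 ≤ L := by
    have := div_nonpos_of_nonpos_of_nonneg (hnonpos M) (hpos M).le
    linarith
  have haM : M - (L + 1) / δ < M := by
    have : 0 < (L + 1) / δ := by positivity
    linarith
  obtain ⟨x, hx, hxe⟩ := exists_hasDerivAt_eq_slope (fun y => deriv φ y / φ y) _ haM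
    (fun y _ => (hw y).continuousAt.continuousWithinAt) (fun y _ => hw y)
  have h7 := hwle x hx.2.le
  rw [hxe, div_le_iff₀ (by linarith)] at h7
  have h8 : -δ * (M - (M - (L + 1) / δ)) = -(L + 1) := by
    field_simp
    ring
  have h9 := div_nonpos_of_nonpos_of_nonneg (hnonpos (M - (L + 1) / δ)) (hpos (M - (L + 1) / δ)).le
  rw [h8] at h7
  linarith
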